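/- Let T be a finite tree whose diameter is odd and which has at least two distinct diametrical pairs, i.e., there exist two distinct unordered pairs of vertices each at distance equal to the diameter of T. Then the girth of the eccentric graph E(T) equals 4 (in particular E(T) contains a 4-cycle but no triangle). -/

import Mathlib

open SimpleGraph

/-- The eccentricity of a vertex `v`: the max distance from `v` to any vertex. -/
noncomputable def ecc {V : Type*} [Fintype V] (G : SimpleGraph V) (v : V) : ℕ :=
  Finset.univ.sup fun u => G.dist v u

/-- `u` is eccentric to `v` in `G` if `d(v,u) = e(v)`. -/
def IsEccentric {V : Type*} [Fintype V] (G : SimpleGraph V) (v u : V) : Prop :=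
  G.dist v u = ecc G v

/-- The eccentric graph of `G`: distinct `u, v` adjacent iff one is eccentric to the other. -/
noncomputable def eccGraph {V : Type*} [Fintype V] (G : SimpleGraph V) : SimpleGraph V :=
  SimpleGraph.fromRel fun u v => IsEccentric G u v

/-- The diameter of `G`: the maximum eccentricity. -/
noncomputable def gdiam {V : Type*} [Fintype V] (G : SimpleGraph V) : ℕ :=
  Finset.univ.sup fun v => ecc G v

lemma SimpleGraph.Walk.dist_eq_dist_add_dist {V : Type*} {G : SimpleGraph V} {u v w : V}
    (hG : G.Connected) {p : G.Walk u v} (hp : p.length = G.dist u v) (hw : w ∈ p.support) :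
    G.dist u v = G.dist u w + G.dist w v := by
  obtain ⟨q, r, rfl⟩ := Walk.mem_support_iff_exists_append.mp hw
  rw [Walk.length_append] at hp
  have := dist_le q
  have := dist_le r
  have := hG.dist_triangle (u := u) (v := w) (w := v)
  omega

/-- In a tree, the geodesic between vertices on different sides of an edge crosses that edge. -/
lemma SimpleGraph.IsTree.dist_eq_of_adj_of_lt {V : Type*} {T : SimpleGraph V} (hT : T.IsTree)
    {x y u v : V} (h : T.Adj x y) (hu : T.dist u x < T.dist u y) (hv : T.dist v y < T.dist v x) :
    T.dist u v = T.dist u x + 1 + T.dist v y := by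
  have hc := hT.connected
  obtain ⟨p, hp, hpl⟩ := hc.exists_path_of_dist u x
  obtain ⟨q, hq, hql⟩ := hc.exists_path_of_dist y v
  obtain ⟨s, hs, hsl⟩ := hc.exists_path_of_dist u v
  have hpq : (p.append (.cons h q)).IsPath := by
    rw [Walk.isPath_def, Walk.support_append, Walk.support_cons, List.tail_cons,
      List.nodup_append']
    refine ⟨hp.support_nodup, hq.support_nodup, fun w hwp hwq ↦ ?_⟩
    have h₁ := Walk.dist_eq_dist_add_dist hc hpl hwp
    have h₂ := Walk.dist_eq_dist_add_dist hc hql hwq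
    have h₃ := hc.dist_triangle (u := u) (v := w) (w := y)
    have h₄ := hc.dist_triangle (u := v) (v := w) (w := x)
    rw [T.dist_comm (u := y) (v := v), T.dist_comm (u := y) (v := w),
      T.dist_comm (u := w) (v := v)] at h₂
    omega
  have := congrArg (fun p : T.Path u v ↦ p.1.length)
    ((hT.isAcyclic.subsingleton_path u v).elim ⟨s, hs⟩ ⟨_, hpq⟩)
  simp only [Walk.length_append, Walk.length_cons] at this
  rw [T.dist_comm (u := v) (v := y)]
  omega

section Eccentricity

variable {V : Type*} [Fintype V] {G : SimpleGraph V}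

lemma dist_le_ecc (u v : V) : G.dist u v ≤ ecc G u :=
  Finset.le_sup (f := fun w ↦ G.dist u w) (Finset.mem_univ v)

lemma dist_le_gdiam (u v : V) : G.dist u v ≤ gdiam G :=
  (dist_le_ecc u v).trans (Finset.le_sup (f := fun w ↦ ecc G w) (Finset.mem_univ u))

lemma isEccentric_iff {u v : V} : IsEccentric G u v ↔ ∀ w, G.dist u w ≤ G.dist u v := by
  refine ⟨fun h w ↦ (dist_le_ecc u w).trans_eq h.symm, fun h ↦ ?_⟩
  exact (dist_le_ecc u v).antisymm (Finset.sup_le fun w _ ↦ h w)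

lemma eccGraph_adj {u v : V} :
    (eccGraph G).Adj u v ↔ u ≠ v ∧ (IsEccentric G u v ∨ IsEccentric G v u) :=
  fromRel_adj _ _ _

end Eccentricity

/-- `IsCentralEdge T x y r` says that `xy` is an edge of `T` in the middle of a geodesic of length
`2 * r + 1`, and that `T` has diameter at most `2 * r + 1`. -/
structure IsCentralEdge {V : Type*} (T : SimpleGraph V) (x y : V) (r : ℕ) : Prop where
  adj : T.Adj x y
  dist_le : ∀ u v, T.dist u v ≤ 2 * r + 1
  exists_left : ∃ a, T.dist a x = r ∧ T.dist a x < T.dist a y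
  exists_right : ∃ b, T.dist b y = r ∧ T.dist b y < T.dist b x

lemma exists_isCentralEdge {V : Type*} [Fintype V] {T : SimpleGraph V} (hT : T.Connected)
    {a b : V} {r : ℕ} (hab : T.dist a b = 2 * r + 1) (hdiam : gdiam T = 2 * r + 1) :
    ∃ x y, IsCentralEdge T x y r := by
  obtain ⟨p, hp⟩ := hT.exists_walk_length_eq_dist a b
  have hadj := p.adj_getVert_succ (i := r) (by omega)
  have h₁ := dist_le (p.take r)
  have h₂ := dist_le (p.drop (r + 1))
  rw [Walk.take_length] at h₁
  rw [Walk.drop_length] at h₂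
  have h₃ := dist_eq_one_iff_adj.mpr hadj
  have h₄ := hT.dist_triangle (u := a) (v := p.getVert r) (w := b)
  have h₅ := hT.dist_triangle (u := p.getVert r) (v := p.getVert (r + 1)) (w := b)
  have h₆ := hT.dist_triangle (u := a) (v := p.getVert (r + 1)) (w := b)
  have hb := T.dist_comm (u := b) (v := p.getVert r)
  have hb' := T.dist_comm (u := b) (v := p.getVert (r + 1))
  exact ⟨_, _, hadj, fun u v ↦ hdiam ▸ dist_le_gdiam u v, ⟨a, by omega, by omega⟩,
    ⟨b, by omega, by omega⟩⟩

namespace IsCentralEdge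

variable {V : Type*} {T : SimpleGraph V} {x y u v : V} {r : ℕ}

lemma symm (h : IsCentralEdge T x y r) : IsCentralEdge T y x r :=
  ⟨h.adj.symm, h.dist_le, h.exists_right, h.exists_left⟩

lemma dist_le_of_lt (h : IsCentralEdge T x y r) (hT : T.IsTree) (hu : T.dist u x < T.dist u y) :
    T.dist u x ≤ r := by
  obtain ⟨b, hb, hb'⟩ := h.exists_right
  have := hT.dist_eq_of_adj_of_lt h.adj hu hb'
  have := h.dist_le u b
  omega

lemma dist_le_add_of_lt (h : IsCentralEdge T x y r) (hT : T.IsTree)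
    (hv : T.dist v x < T.dist v y) : T.dist u v ≤ T.dist u x + r := by
  have := h.dist_le_of_lt hT hv
  have := hT.connected.dist_triangle (u := u) (v := x) (w := v)
  have := T.dist_comm (u := x) (v := v)
  omega

lemma isEccentric_iff_of_lt [Fintype V] (h : IsCentralEdge T x y r) (hT : T.IsTree)
    (hu : T.dist u x < T.dist u y) :
    IsEccentric T u v ↔ T.dist v y < T.dist v x ∧ T.dist v y = r := by
  rw [isEccentric_iff]
  obtain ⟨b, hb, hb'⟩ := h.exists_right
  have hub := hT.dist_eq_of_adj_of_lt h.adj hu hb'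
  refine ⟨fun he ↦ ?_, fun ⟨hv, hvr⟩ w ↦ ?_⟩
  · have := he b
    rcases (hT.dist_ne_of_adj v h.adj).lt_or_gt with hv | hv
    · have := h.dist_le_add_of_lt (u := u) hT hv
      omega
    · have := hT.dist_eq_of_adj_of_lt h.adj hu hv
      have := h.symm.dist_le_of_lt hT hv
      omega
  · have := hT.dist_eq_of_adj_of_lt h.adj hu hv
    rcases (hT.dist_ne_of_adj w h.adj).lt_or_gt with hw | hw
    · have := h.dist_le_add_of_lt (u := u) hT hw
      omega
    · have := hT.dist_eq_of_adj_of_lt h.adj hu hw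
      have := h.symm.dist_le_of_lt hT hw
      omega

lemma lt_iff_not_lt_of_eccGraph_adj [Fintype V] (h : IsCentralEdge T x y r) (hT : T.IsTree)
    (huv : (eccGraph T).Adj u v) : T.dist u x < T.dist u y ↔ ¬ T.dist v x < T.dist v y := by
  wlog he : IsEccentric T u v generalizing u v
  · have := this huv.symm ((eccGraph_adj.mp huv).2.resolve_left he)
    tauto
  rcases (hT.dist_ne_of_adj u h.adj).lt_or_gt with hu | hu
  · have := (h.isEccentric_iff_of_lt hT hu).mp he
    omega
  · have := (h.symm.isEccentric_iff_of_lt hT hu).mp he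
    omega

lemma eccGraph_colorable_two [Fintype V] (h : IsCentralEdge T x y r) (hT : T.IsTree) :
    (eccGraph T).Colorable 2 := by
  let c : (eccGraph T).Coloring Prop := Coloring.mk (fun u ↦ T.dist u x < T.dist u y)
    fun huv heq ↦ by
      have := h.lt_iff_not_lt_of_eccGraph_adj hT huv
      rw [heq] at this
      tauto
  simpa using c.colorable

lemma eccGraph_adj_of_lt [Fintype V] (h : IsCentralEdge T x y r) (hT : T.IsTree)
    (hu : T.dist u x < T.dist u y) (hv : T.dist v y < T.dist v x) (hvr : T.dist v y = r) :
    (eccGraph T).Adj u v := by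
  refine eccGraph_adj.mpr ⟨?_, .inl ((h.isEccentric_iff_of_lt hT hu).mpr ⟨hv, hvr⟩)⟩
  rintro rfl
  omega

/-- Two distinct deepest vertices on one side of the central edge yield a 4-cycle. -/
lemma egirth_eccGraph_le [Fintype V] (h : IsCentralEdge T x y r) (hT : T.IsTree) {a a' : V}
    (ha : T.dist a x < T.dist a y) (har : T.dist a x = r)
    (ha' : T.dist a' x < T.dist a' y) (har' : T.dist a' x = r) (hne : a ≠ a') :
    (eccGraph T).egirth ≤ 4 := by
  obtain ⟨b, hbr, hb⟩ := h.exists_right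
  have hy : T.dist y y < T.dist y x := by
    rw [dist_self, dist_eq_one_iff_adj.mpr h.adj.symm]
    exact one_pos
  have hby : b ≠ y := by
    rintro rfl
    rw [dist_self] at hbr
    have hax := hT.connected.dist_eq_zero_iff.mp (har.trans hbr.symm)
    have hax' := hT.connected.dist_eq_zero_iff.mp (har'.trans hbr.symm)
    exact hne (hax.trans hax'.symm)
  have h₁ := h.eccGraph_adj_of_lt hT ha hb hbr
  have h₂ := h.eccGraph_adj_of_lt hT ha' hb hbr
  have h₃ := h.symm.eccGraph_adj_of_lt hT hy ha' har'
  have h₄ := h.symm.eccGraph_adj_of_lt hT hy ha har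
  have hcyc : (Walk.cons h₁ (.cons h₂.symm (.cons h₃.symm (.cons h₄ .nil)))).IsCycle := by
    have := h₁.ne
    have := h₂.ne
    have := h₃.ne
    have := h₄.ne
    simp only [Walk.cons_isCycle_iff, Walk.isPath_def, Walk.support_cons, Walk.support_nil,
      Walk.edges_cons, Walk.edges_nil]
    grind
  simpa using egirth_le_length hcyc

end IsCentralEdge

/-- If a finite tree has odd diameter and at least two distinct diametrical pairs, the girth of
its eccentric graph is 4. -/
theorem stmt_3 {V : Type*} [Fintype V] (T : SimpleGraph V) (hT : T.IsTree)
    (hodd : Odd (gdiam T))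
    (htwo : ∃ a b a' b' : V, T.dist a b = gdiam T ∧ T.dist a' b' = gdiam T ∧
      s(a, b) ≠ s(a', b')) :
    (eccGraph T).egirth = 4 := by
  obtain ⟨a, b, a', b', hab, hab', hne⟩ := htwo
  obtain ⟨r, hr⟩ := hodd
  obtain ⟨x, y, h⟩ := exists_isCentralEdge hT.connected (hab.trans hr) hr
  apply le_antisymm
  · have oriented (c d : V) (hcd : T.dist c d = gdiam T) : ∃ c' d', s(c, d) = s(c', d') ∧
        (T.dist c' x < T.dist c' y ∧ T.dist c' x = r) ∧
        (T.dist d' y < T.dist d' x ∧ T.dist d' y = r) := by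
      have hcd' : IsEccentric T c d := isEccentric_iff.mpr fun w ↦ hcd ▸ dist_le_gdiam c w
      have hdc' : IsEccentric T d c := isEccentric_iff.mpr fun w ↦ by
        rw [T.dist_comm (u := d) (v := c), hcd]
        exact dist_le_gdiam d w
      rcases (hT.dist_ne_of_adj c h.adj).lt_or_gt with hc | hc
      · have hd := (h.isEccentric_iff_of_lt hT hc).mp hcd'
        exact ⟨c, d, rfl, (h.symm.isEccentric_iff_of_lt hT hd.1).mp hdc', hd⟩
      · have hd := (h.symm.isEccentric_iff_of_lt hT hc).mp hcd'
        exact ⟨d, c, Sym2.eq_swap, hd, (h.isEccentric_iff_of_lt hT hd.1).mp hdc'⟩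
    obtain ⟨c, d, hcd, hc, hd⟩ := oriented a b hab
    obtain ⟨c', d', hcd', hc', hd'⟩ := oriented a' b' hab'
    rw [hcd, hcd'] at hne
    by_cases hcc : c = c'
    · have hdd : d ≠ d' := fun hdd ↦ hne (by rw [hcc, hdd])
      exact h.symm.egirth_eccGraph_le hT hd.1 hd.2 hd'.1 hd'.2 hdd
    · exact h.egirth_eccGraph_le hT hc.1 hc.2 hc'.1 hc'.2 hcc
  · refine le_egirth.mpr fun u w hw ↦ ?_
    have heven := two_colorable_iff_forall_loop_even.mp (h.eccGraph_colorable_two hT) u w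
    have := hw.three_le_length
    have : 4 ≤ w.length := by grind
    exact_mod_cast this
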